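/- arXiv:1704.07952 — 2 statements merged into one kernel-verified Lean document; each statement's English description precedes it below -/
import Mathlib

section
/- Let λ > 0, c > 0, α > 2 and R ≥ 0. For each N ∈ ℕ, let X_N be uniformly distributed on the closed disk in ℝ² of radius ρ_N = √(cN/(πλ)) centered at the origin. Then for every τ > (πλ/c)^{α/2}, lim_{N→∞} P( N^{α/2} (‖X_N‖ + R)^{−α} ≤ τ ) = 1 − (πλ/c) τ^{−2/α}. -/
open MeasureTheory Filter

/-- A path loss `n ^ (α / 2) * d ^ (-α)` is at most `τ` iff the distance `d` is at least
`√n * τ ^ (-1 / α)`. -/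
lemma pathLoss_le_iff {n d α τ : ℝ} (hn : 0 ≤ n) (hd : 0 < d) (hα : 0 < α) (hτ : 0 < τ) :
    n ^ (α / 2) * d ^ (-α) ≤ τ ↔ Real.sqrt n * τ ^ (-1 / α) ≤ d := by
  have hn' : n ^ (α / 2) = Real.sqrt n ^ α := by
    rw [Real.sqrt_eq_rpow, ← Real.rpow_mul hn]
    ring_nf
  have hτ' : τ * d ^ α = (τ ^ (1 / α) * d) ^ α := by
    rw [Real.mul_rpow (by positivity) hd.le, ← Real.rpow_mul hτ.le, one_div_mul_cancel hα.ne',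
      Real.rpow_one]
  rw [Real.rpow_neg hd.le, ← div_eq_mul_inv, div_le_iff₀ (by positivity), hn', hτ',
    Real.rpow_le_rpow_iff (by positivity) (by positivity) hα, neg_div, Real.rpow_neg hτ.le,
    ← div_eq_mul_inv, div_le_iff₀ (by positivity), mul_comm d]

/-- The probability that a uniform point of the disk of radius `ρ` lies in a set which away from
the origin is the complement of the disk of radius `s`. -/
lemma uniform_disk_apply_outside {s ρ : ℝ} (hs : 0 ≤ s) (hρ : 0 < ρ) (hsρ : s ≤ ρ)
    {S : Set (EuclideanSpace ℝ (Fin 2))} (hS : ∀ y, y ≠ 0 → (y ∈ S ↔ s ≤ ‖y‖)) :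
    (((volume (Metric.closedBall (0 : EuclideanSpace ℝ (Fin 2)) ρ))⁻¹ •
      volume.restrict (Metric.closedBall (0 : EuclideanSpace ℝ (Fin 2)) ρ)) S).toReal =
      1 - (s / ρ) ^ 2 := by
  have hae : S =ᵐ[volume.restrict (Metric.closedBall (0 : EuclideanSpace ℝ (Fin 2)) ρ)]
      ((Metric.ball 0 s)ᶜ : Set (EuclideanSpace ℝ (Fin 2))) := by
    refine ae_restrict_of_ae ?_
    filter_upwards [Measure.ae_ne volume (0 : EuclideanSpace ℝ (Fin 2))] with y hy
    refine propext ((hS y hy).trans ?_)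
    change _ ↔ y ∈ (Metric.ball 0 s)ᶜ
    simp
  have hsub : Metric.ball (0 : EuclideanSpace ℝ (Fin 2)) s ⊆ Metric.closedBall 0 ρ :=
    Metric.ball_subset_closedBall.trans (Metric.closedBall_subset_closedBall hsρ)
  rw [Measure.smul_apply, measure_congr hae,
    Measure.restrict_apply Metric.isOpen_ball.measurableSet.compl, Set.inter_comm,
    ← Set.sdiff_eq, smul_eq_mul, ENNReal.toReal_mul, ENNReal.toReal_inv,
    measure_sdiff hsub Metric.isOpen_ball.measurableSet.nullMeasurableSet measure_ball_lt_top.ne,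
    ENNReal.toReal_sub_of_le (measure_mono hsub) measure_closedBall_lt_top.ne,
    EuclideanSpace.volume_closedBall_fin_two, EuclideanSpace.volume_ball_fin_two]
  simp only [ENNReal.toReal_mul, ENNReal.toReal_pow, ENNReal.toReal_ofReal hs,
    ENNReal.toReal_ofReal hρ.le, ENNReal.toReal_ofReal Real.pi_nonneg]
  have := Real.pi_pos
  field_simp

/-- Core computation of Lemma 6: for `X_N` uniform on the disk of radius
`√(cN/(πλ))` and any fixed offset `R ≥ 0`, for `τ > (πλ/c)^{α/2}`,
`P(N^{α/2} (‖X_N‖ + R)^{−α} ≤ τ) → 1 − (πλ/c) τ^{−2/α}`. -/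
theorem stmt8 (lam c α R : ℝ) (hlam : 0 < lam) (hc : 0 < c) (hα : 2 < α) (hR : 0 ≤ R)
    (τ : ℝ) (hτ : (Real.pi * lam / c) ^ (α / 2) < τ) :
    Tendsto (fun N : ℕ =>
      (((volume (Metric.closedBall (0 : EuclideanSpace ℝ (Fin 2))
              (Real.sqrt (c * N / (Real.pi * lam)))))⁻¹ •
          volume.restrict (Metric.closedBall (0 : EuclideanSpace ℝ (Fin 2))
              (Real.sqrt (c * N / (Real.pi * lam)))))
        {y : EuclideanSpace ℝ (Fin 2) | (N : ℝ) ^ (α / 2) * (‖y‖ + R) ^ (-α) ≤ τ}).toReal)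
      atTop (nhds (1 - (Real.pi * lam / c) * τ ^ (-2 / α))) := by
  set a := Real.pi * lam / c with ha_def
  have ha : 0 < a := by have := Real.pi_pos; positivity
  have hα0 : 0 < α := by linarith
  have hτ0 : 0 < τ := (by positivity : (0 : ℝ) ≤ a ^ (α / 2)).trans_lt hτ
  set t := τ ^ (-1 / α) with ht_def
  have ht : 0 < t := by positivity
  have ht2 : t ^ 2 = τ ^ (-2 / α) := by
    rw [ht_def, ← Real.rpow_natCast, ← Real.rpow_mul hτ0.le]
    congr 1
    push_cast
    ring
  have hta : a * t ^ 2 ≤ 1 := by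
    have h : a ≤ τ ^ (2 / α) := by
      calc a = (a ^ (α / 2)) ^ (2 / α) := by
            rw [← Real.rpow_mul ha.le, div_mul_div_cancel₀' hα0.ne', div_self two_ne_zero,
              Real.rpow_one]
        _ ≤ τ ^ (2 / α) := Real.rpow_le_rpow (by positivity) hτ.le (by positivity)
    rw [ht2, neg_div, Real.rpow_neg hτ0.le, ← div_eq_mul_inv]
    exact div_le_one_of_le₀ h (by positivity)
  have hsqrt : Tendsto (fun N : ℕ => Real.sqrt N) atTop atTop :=
    Real.tendsto_sqrt_atTop.comp tendsto_natCast_atTop_atTop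
  have hlim : Tendsto (fun N : ℕ => 1 - a * (t - R / Real.sqrt N) ^ 2) atTop
      (nhds (1 - a * τ ^ (-2 / α))) := by
    have h := ((hsqrt.const_div_atTop R).const_sub t).pow 2
    rw [sub_zero, ht2] at h
    exact (h.const_mul a).const_sub 1
  refine hlim.congr' ?_
  filter_upwards [(hsqrt.atTop_mul_const ht).eventually_ge_atTop R, eventually_gt_atTop 0]
    with N hN hNpos
  have hN0 : (0 : ℝ) < N := by exact_mod_cast hNpos
  have hNa : c * N / (Real.pi * lam) = N / a := by rw [ha_def]; field_simp
  have hsN : Real.sqrt N * t - R ≤ Real.sqrt (N / a) := by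
    refine (sub_le_self _ hR).trans (Real.le_sqrt_of_sq_le ?_)
    rw [mul_pow, Real.sq_sqrt hN0.le, le_div_iff₀ ha]
    nlinarith
  rw [hNa, uniform_disk_apply_outside (sub_nonneg.2 hN) (by positivity) hsN]
  · rw [div_pow, Real.sq_sqrt (by positivity)]
    have hs : 0 < Real.sqrt N := Real.sqrt_pos.2 hN0
    have h : t - R / Real.sqrt N = (Real.sqrt N * t - R) / Real.sqrt N := by field_simp
    rw [h, div_pow, Real.sq_sqrt hN0.le]
    field_simp
  · intro y hy
    have hy' : 0 < ‖y‖ + R := by have := norm_pos_iff.2 hy; positivity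
    rw [Set.mem_ofPred_eq, pathLoss_le_iff hN0.le hy' hα0 hτ0, sub_le_iff_le_add]
end

section
/- Let α > 2 and C > 0, and define f(λ) = λ · log₂(1 + C λ^{−α/2}) for λ > 0. Suppose w ∈ (−1, 0) satisfies w e^w = −(α/2) e^{−α/2}. Then λ* = (−2w/(2w + α))^{2/α} · C^{2/α} satisfies f(λ) ≤ f(λ*) for all λ > 0. -/
/-- If the zero-truncated Poisson law of parameter `L` has mean `a`, then its generating function
dominates `s ↦ s ^ a`. -/
theorem mul_rpow_le_exp_mul_sub_one {L s a : ℝ} (hL : 0 ≤ L) (hs : 0 < s)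
    (ha : a * (Real.exp L - 1) = L * Real.exp L) :
    (Real.exp L - 1) * s ^ a ≤ Real.exp (L * s) - 1 := by
  have hexp (x : ℝ) : HasSum (fun n : ℕ ↦ x ^ n / n.factorial) (Real.exp x) := by
    rw [Real.exp_eq_exp_ℝ]
    exact NormedSpace.expSeries_div_hasSum_exp x
  have htail (x : ℝ) :
      HasSum (fun n : ℕ ↦ x ^ (n + 1) / (n + 1).factorial) (Real.exp x - 1) := by
    simpa using (hasSum_nat_add_iff' 1).2 (hexp x)
  have hmean : HasSum (fun n : ℕ ↦ ((n : ℝ) + 1) * (L ^ (n + 1) / (n + 1).factorial))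
      (L * Real.exp L) := by
    convert! (hexp L).mul_left L using 1
    ext n
    rw [Nat.factorial_succ]
    push_cast
    field_simp
    exact pow_succ' L n
  have hlower := (((htail L).mul_right (1 - a * Real.log s)).add
    (hmean.mul_right (Real.log s))).mul_left (s ^ a)
  have hle := hasSum_le (fun n ↦ ?_) hlower (htail (L * s))
  · linear_combination hle + s ^ a * Real.log s * ha
  · have hpow : s ^ (n + 1) = s ^ a * Real.exp (((n : ℝ) + 1 - a) * Real.log s) := by
      rw [mul_comm _ (Real.log s), ← Real.rpow_def_of_pos hs, ← Real.rpow_add hs,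
        ← Real.rpow_natCast]
      push_cast
      ring_nf
    have htangent := Real.add_one_le_exp (((n : ℝ) + 1 - a) * Real.log s)
    calc
      _ = L ^ (n + 1) / (n + 1).factorial *
          (s ^ a * (((n : ℝ) + 1 - a) * Real.log s + 1)) := by ring
      _ ≤ L ^ (n + 1) / (n + 1).factorial *
          (s ^ a * Real.exp (((n : ℝ) + 1 - a) * Real.log s)) := by gcongr
      _ = _ := by rw [← hpow, mul_pow]; ring

/-- Optimal active mobile density: `λ* = (−2w/(2w+α))^{2/α} C^{2/α}` maximizes the rate
density `f(λ) = λ log₂(1 + C λ^{−α/2})`, where `w` is the Lambert-W value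
`Ω(−(α/2)e^{−α/2})` on the principal branch. -/
theorem stmt11 (α C : ℝ) (hα : 2 < α) (hC : 0 < C)
    (w : ℝ) (hw : w ∈ Set.Ioo (-1 : ℝ) 0)
    (hww : w * Real.exp w = -(α / 2) * Real.exp (-α / 2)) :
    ∀ lam : ℝ, 0 < lam →
      lam * Real.logb 2 (1 + C * lam ^ (-α / 2)) ≤
      ((-2 * w / (2 * w + α)) ^ (2 / α) * C ^ (2 / α)) *
        Real.logb 2 (1 + C * ((-2 * w / (2 * w + α)) ^ (2 / α) * C ^ (2 / α)) ^ (-α / 2)) := by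
  intro lam hlam
  obtain ⟨hw1, hw0⟩ := hw
  have hβ : 0 < -2 * w / (2 * w + α) := div_pos (by linarith) (by linarith)
  have hL : 0 < w + α / 2 := by linarith
  have hexp : w * Real.exp (w + α / 2) = -(α / 2) := by
    rw [Real.exp_add, ← mul_assoc, hww, mul_assoc, ← Real.exp_add]
    ring_nf
    simp
  set m := (-2 * w / (2 * w + α)) ^ (2 / α) * C ^ (2 / α) with hm
  have hm0 : 0 < m := by positivity
  have hopt : C * m ^ (-α / 2) = Real.exp (w + α / 2) - 1 := by
    have hα0 : α ≠ 0 := by linarith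
    have hden : 2 * w + α ≠ 0 := by linarith
    rw [hm, ← Real.mul_rpow hβ.le hC.le, ← Real.rpow_mul (by positivity),
      show 2 / α * (-α / 2) = -1 by field_simp, Real.rpow_neg_one, mul_inv, inv_div,
      mul_left_comm, mul_inv_cancel₀ hC.ne', mul_one, div_eq_iff (by linarith)]
    linear_combination 2 * hexp
  have hscale : C * lam ^ (-α / 2) = (Real.exp (w + α / 2) - 1) * (m / lam) ^ (α / 2) := by
    rw [← hopt, Real.div_rpow hm0.le hlam.le, neg_div, Real.rpow_neg hlam.le,
      Real.rpow_neg hm0.le]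
    have := (Real.rpow_pos_of_pos hm0 (α / 2)).ne'
    field_simp
  have hbound : 1 + C * lam ^ (-α / 2) ≤ Real.exp ((w + α / 2) * (m / lam)) := by
    have := mul_rpow_le_exp_mul_sub_one (a := α / 2) hL.le (div_pos hm0 hlam)
      (by linear_combination -hexp)
    linarith
  have hlog : Real.log (1 + C * lam ^ (-α / 2)) ≤ (w + α / 2) * (m / lam) :=
    (Real.log_le_iff_le_exp (by positivity)).2 hbound
  rw [hopt, add_sub_cancel, Real.logb, Real.logb, Real.log_exp, ← mul_div_assoc, ← mul_div_assoc]
  have hlog2 : 0 < Real.log 2 := Real.log_pos one_lt_two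
  refine div_le_div_of_nonneg_right ?_ hlog2.le
  calc
    _ ≤ lam * ((w + α / 2) * (m / lam)) := by gcongr
    _ = _ := by field_simp
end
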